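/- (L⁴ Strichartz estimate for Klein–Gordon exponential sums, Proposition 4.2, first estimate.) For every bounded interval I ⊂ ℝ there exists a constant C(I) > 0 such that for every N ≥ 1 and every family of complex coefficients (a(n))_{n ∈ S_N}, the function f(t, x) = ∑_{n ∈ S_N} a(n) exp(i(n·x + t⟨n⟩)) satisfies ‖f‖_{L⁴(I × T³)} ≤ C(I) N^{1/2} (∑_{n ∈ S_N} |a(n)|²)^{1/2}. -/

import Mathlib

open MeasureTheory

/-- The torus `T³`, realized as the cube `[0, 2π)³` in `ℝ³` (with Lebesgue measure). -/
noncomputable def cube : Set (Fin 3 → ℝ) := Set.univ.pi fun _ => Set.Ico (0:ℝ) (2 * Real.pi)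

/-- The Euclidean norm `|n|` of a lattice point `n ∈ ℤ³`. -/
noncomputable def normZ (n : Fin 3 → ℤ) : ℝ := Real.sqrt (∑ i, ((n i : ℝ)) ^ 2)

/-- The Japanese bracket `⟨n⟩ = (1 + |n|²)^{1/2}` of a lattice point `n ∈ ℤ³`. -/
noncomputable def jbZ (n : Fin 3 → ℤ) : ℝ := Real.sqrt (1 + ∑ i, ((n i : ℝ)) ^ 2)

/-- The Euclidean inner product `n·x` for `n ∈ ℤ³`, `x ∈ ℝ³`. -/
noncomputable def dotZ (n : Fin 3 → ℤ) (x : Fin 3 → ℝ) : ℝ := ∑ i, (n i : ℝ) * x i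

open scoped Classical in
/-- The dyadic annulus `S_N = {n ∈ ℤ³ : N ≤ |n| < 2N}`, as a finite set of lattice points. -/
noncomputable def annulus (N : ℝ) : Finset (Fin 3 → ℤ) :=
  (Finset.Icc (fun _ => -⌈2 * N⌉) fun _ => ⌈2 * N⌉).filter fun n =>
    N ≤ normZ n ∧ normZ n < 2 * N


/-! ### Volumes of shells between confocal ellipsoids -/

section Geometry

open scoped RealInnerProductSpace

variable {E : Type*} [NormedAddCommGroup E]

lemma sqrt_one_add_norm_sq_le_add_norm_sub (x y : E) :
    √(1 + ‖x‖ ^ 2) ≤ √(1 + ‖y‖ ^ 2) + ‖x - y‖ := by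
  have h1 : ‖x‖ ≤ ‖y‖ + ‖x - y‖ := norm_le_norm_add_norm_sub' x y
  have h2 : ‖y‖ ≤ √(1 + ‖y‖ ^ 2) := Real.le_sqrt_of_sq_le (by linarith)
  have h3 := Real.sq_sqrt (show 0 ≤ 1 + ‖y‖ ^ 2 by positivity)
  rw [Real.sqrt_le_iff]
  refine ⟨by positivity, ?_⟩
  nlinarith [norm_nonneg x, norm_nonneg y, norm_nonneg (x - y),
    mul_le_mul_of_nonneg_right h2 (norm_nonneg (x - y)),
    mul_self_le_mul_self (norm_nonneg x) h1]

variable [InnerProductSpace ℝ E]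

/-- The sum of the Japanese brackets of `m / 2 + k` and `m / 2 - k`; its sublevel sets are
ellipsoids. -/
noncomputable def bracketSum (m k : E) : ℝ :=
  √(1 + ‖k + (1 / 2 : ℝ) • m‖ ^ 2) + √(1 + ‖k - (1 / 2 : ℝ) • m‖ ^ 2)

lemma continuous_bracketSum (m : E) : Continuous (bracketSum m) := by
  unfold bracketSum
  fun_prop

lemma bracketSum_le_add (m x y : E) : bracketSum m x ≤ bracketSum m y + 2 * ‖x - y‖ := by
  have h1 := sqrt_one_add_norm_sq_le_add_norm_sub (x + (1 / 2 : ℝ) • m) (y + (1 / 2 : ℝ) • m)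
  have h2 := sqrt_one_add_norm_sq_le_add_norm_sub (x - (1 / 2 : ℝ) • m) (y - (1 / 2 : ℝ) • m)
  rw [add_sub_add_right_eq_sub] at h1
  rw [sub_sub_sub_cancel_right] at h2
  unfold bracketSum
  linarith

lemma norm_lt_bracketSum (m k : E) : ‖m‖ < bracketSum m k := by
  have h (x : E) : ‖x‖ < √(1 + ‖x‖ ^ 2) := Real.lt_sqrt_of_sq_lt (by linarith)
  have h1 := h (k + (1 / 2 : ℝ) • m)
  have h2 := h (k - (1 / 2 : ℝ) • m)
  have h3 : ‖m‖ ≤ ‖k + (1 / 2 : ℝ) • m‖ + ‖k - (1 / 2 : ℝ) • m‖ := by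
    refine le_trans (le_of_eq ?_) (norm_sub_le _ _)
    congr 1
    module
  unfold bracketSum
  linarith

lemma bracketSum_le_iff {m : E} {σ : ℝ} (hσ : ‖m‖ < σ) (k : E) :
    bracketSum m k ≤ σ ↔
      ‖k‖ ^ 2 - (⟪m, k⟫ / σ) ^ 2 ≤ (σ ^ 2 - ‖m‖ ^ 2 - 4) / 4 := by
  have hσ0 : 0 < σ := (norm_nonneg m).trans_lt hσ
  have hτ := norm_lt_bracketSum m k
  have hl := sqrt_one_add_norm_sq_le_add_norm_sub (k + (1 / 2 : ℝ) • m) (k - (1 / 2 : ℝ) • m)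
  have hr := sqrt_one_add_norm_sq_le_add_norm_sub (k - (1 / 2 : ℝ) • m) (k + (1 / 2 : ℝ) • m)
  rw [norm_sub_rev (k - (1 / 2 : ℝ) • m)] at hr
  have hm : k + (1 / 2 : ℝ) • m - (k - (1 / 2 : ℝ) • m) = m := by module
  rw [hm] at hl hr
  have hp := Real.sq_sqrt (show 0 ≤ 1 + ‖k + (1 / 2 : ℝ) • m‖ ^ 2 by positivity)
  have hq := Real.sq_sqrt (show 0 ≤ 1 + ‖k - (1 / 2 : ℝ) • m‖ ^ 2 by positivity)
  unfold bracketSum at hτ ⊢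
  set p := √(1 + ‖k + (1 / 2 : ℝ) • m‖ ^ 2)
  set q := √(1 + ‖k - (1 / 2 : ℝ) • m‖ ^ 2)
  rw [norm_add_sq_real, norm_smul, real_inner_smul_right, real_inner_comm m k] at hp
  rw [norm_sub_sq_real, norm_smul, real_inner_smul_right, real_inner_comm m k] at hq
  norm_num at hp hq
  have hpq : (p + q) * (p - q) = 2 * ⟪m, k⟫ := by linear_combination hp - hq
  have hs : p ^ 2 + q ^ 2 = 2 + 2 * ‖k‖ ^ 2 + ‖m‖ ^ 2 / 2 := by linear_combination hp + hq
  have key : (σ ^ 2 - ‖m‖ ^ 2 - 4) / 4 - (‖k‖ ^ 2 - (⟪m, k⟫ / σ) ^ 2) =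
      (σ - (p + q)) * ((σ + (p + q)) * (1 - (p - q) ^ 2 / σ ^ 2) / 4) := by
    have : ⟪m, k⟫ = (p + q) * (p - q) / 2 := by linarith
    rw [this]
    field_simp
    linear_combination (8 * σ ^ 2) * hs
  have hpos : 0 < (σ + (p + q)) * (1 - (p - q) ^ 2 / σ ^ 2) / 4 := by
    have : (p - q) ^ 2 / σ ^ 2 < 1 := by
      rw [div_lt_one (by positivity)]
      exact sq_lt_sq' (by linarith) (by linarith)
    have h0 : 0 < σ + (p + q) := by linarith [norm_nonneg m]
    have h1 : 0 < 1 - (p - q) ^ 2 / σ ^ 2 := by linarith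
    positivity
  rw [← sub_nonneg, ← sub_nonneg (b := ‖k‖ ^ 2 - _), key, mul_nonneg_iff_of_pos_right hpos]

variable [MeasurableSpace E] [BorelSpace E] [FiniteDimensional ℝ E] (μ : Measure E)
  [μ.IsAddHaarMeasure]

lemma measure_ellipsoid {m : E} {σ r : ℝ} (hσ : ‖m‖ < σ) (hr : 0 ≤ r) :
    μ {k | ‖k‖ ^ 2 - (⟪m, k⟫ / σ) ^ 2 ≤ r ^ 2} =
      ENNReal.ofReal (σ / √(σ ^ 2 - ‖m‖ ^ 2) * r ^ Module.finrank ℝ E) *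
        μ (Metric.ball 0 1) := by
  have hσ0 : 0 < σ := (norm_nonneg m).trans_lt hσ
  have hs : 0 < σ ^ 2 - ‖m‖ ^ 2 := by nlinarith [norm_nonneg m]
  set z := √(σ ^ 2 - ‖m‖ ^ 2) with hz
  have hz0 : 0 < z := Real.sqrt_pos.2 hs
  have hz2 : z ^ 2 = σ ^ 2 - ‖m‖ ^ 2 := Real.sq_sqrt hs.le
  set γ : ℝ := 1 / (σ * (σ + z)) with hγ
  set A : E →ₗ[ℝ] E := LinearMap.transvection (innerₗ E m) (-γ • m) with hA
  have hAk (k : E) : A k = k - (γ * ⟪m, k⟫) • m := by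
    simp only [hA, LinearMap.transvection.apply, innerₗ_apply_apply]
    module
  have hdet : LinearMap.det A = z / σ := by
    rw [hA, LinearMap.transvection.det, innerₗ_apply_apply, real_inner_smul_right,
      real_inner_self_eq_norm_sq, hγ]
    field_simp
    linear_combination -hz2
  have hset : {k | ‖k‖ ^ 2 - (⟪m, k⟫ / σ) ^ 2 ≤ r ^ 2} = A ⁻¹' Metric.closedBall 0 r := by
    ext k
    have : ‖A k‖ ^ 2 = ‖k‖ ^ 2 - (⟪m, k⟫ / σ) ^ 2 := by
      rw [hAk, norm_sub_sq_real, norm_smul, real_inner_smul_right, mul_pow, Real.norm_eq_abs,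
        sq_abs, real_inner_comm m k, hγ]
      field_simp
      linear_combination (⟪m, k⟫ ^ 2) * hz2
    rw [Set.mem_ofPred_eq, ← this, Set.mem_preimage, mem_closedBall_zero_iff,
      sq_le_sq₀ (norm_nonneg _) hr]
  rw [hset, Measure.addHaar_preimage_linearMap μ (by rw [hdet]; positivity),
    Measure.addHaar_closedBall μ 0 hr, hdet, ← mul_assoc, ← ENNReal.ofReal_mul (abs_nonneg _),
    abs_of_nonneg (by positivity), inv_div]

lemma measure_bracketSum_le (hE : Module.finrank ℝ E = 3) (m : E) {σ : ℝ} (hσ : 0 ≤ σ) :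
    μ {k | bracketSum m k ≤ σ} =
      ENNReal.ofReal (σ * (√(σ ^ 2 - ‖m‖ ^ 2 - 4) ^ 3 / √(σ ^ 2 - ‖m‖ ^ 2)) / 8) *
        μ (Metric.ball 0 1) := by
  rcases lt_or_ge (σ ^ 2 - ‖m‖ ^ 2) 4 with h4 | h4
  · have : {k | bracketSum m k ≤ σ} = ∅ := by
      ext k
      simp only [Set.mem_ofPred_eq, Set.mem_empty_iff_false, iff_false]
      intro h
      have hm : ‖m‖ < σ := (norm_lt_bracketSum m k).trans_le h
      rw [bracketSum_le_iff hm, div_pow] at h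
      have h1 : ⟪m, k⟫ ^ 2 / σ ^ 2 ≤ ‖k‖ ^ 2 := by
        rw [div_le_iff₀ (pow_pos ((norm_nonneg m).trans_lt hm) 2), ← sq_abs]
        have h2 : |⟪m, k⟫| ≤ ‖k‖ * σ := by
          nlinarith [abs_real_inner_le_norm m k, norm_nonneg k]
        calc |⟪m, k⟫| ^ 2 ≤ (‖k‖ * σ) ^ 2 := by gcongr
          _ = ‖k‖ ^ 2 * σ ^ 2 := by ring
      linarith
    rw [this, Real.sqrt_eq_zero_of_nonpos (by linarith)]
    simp
  · have hm : ‖m‖ < σ := by nlinarith [norm_nonneg m]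
    have hw := Real.sq_sqrt (show 0 ≤ σ ^ 2 - ‖m‖ ^ 2 - 4 by linarith)
    have : {k | bracketSum m k ≤ σ} = {k | ‖k‖ ^ 2 - (⟪m, k⟫ / σ) ^ 2 ≤
        (√(σ ^ 2 - ‖m‖ ^ 2 - 4) / 2) ^ 2} := by
      ext k
      rw [Set.mem_ofPred_eq, Set.mem_ofPred_eq, bracketSum_le_iff hm, div_pow _ (2 : ℝ), hw]
      norm_num
    rw [this, measure_ellipsoid μ hm (by positivity), hE]
    congr 2
    ring

lemma sqrt_sub_pow_three_div_sqrt_sub_le {s t : ℝ} (hst : s ≤ t) :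
    √(t - 4) ^ 3 / √t - √(s - 4) ^ 3 / √s ≤ 2 * (t - s) := by
  rcases lt_or_ge t 4 with ht | ht
  · rw [Real.sqrt_eq_zero_of_nonpos (show t - 4 ≤ 0 by linarith),
      Real.sqrt_eq_zero_of_nonpos (show s - 4 ≤ 0 by linarith)]
    simp [hst]
  have hw : √(s - 4) ≤ √(t - 4) := Real.sqrt_le_sqrt (by linarith)
  have hw2 : √(t - 4) ^ 2 = t - 4 := Real.sq_sqrt (by linarith)
  have hwz : √(t - 4) ≤ √t := Real.sqrt_le_sqrt (by linarith)
  have hz : 0 < √t := Real.sqrt_pos.2 (by linarith)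
  have hw0 := Real.sqrt_nonneg (s - 4)
  have h1 : √(s - 4) ^ 3 / √t ≤ √(s - 4) ^ 3 / √s := by
    rcases lt_or_ge s 4 with hs | hs
    · rw [Real.sqrt_eq_zero_of_nonpos (show s - 4 ≤ 0 by linarith)]
      simp
    · have : 0 < √s := Real.sqrt_pos.2 (by linarith)
      gcongr
  have h2 : t - 4 - √(s - 4) ^ 2 ≤ t - s := by
    have : s - 4 ≤ √(s - 4) ^ 2 := by
      rcases lt_or_ge s 4 with hs | hs
      · nlinarith
      · rw [Real.sq_sqrt (by linarith)]
    linarith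
  set w := √(t - 4)
  set v := √(s - 4)
  have h3 : (w ^ 3 - v ^ 3) / √t ≤ 2 * (w ^ 2 - v ^ 2) := by
    rw [div_le_iff₀ hz]
    have hd : 0 ≤ w ^ 2 - v ^ 2 := by nlinarith
    calc w ^ 3 - v ^ 3 = (w - v) * (w ^ 2 + w * v + v ^ 2) := by ring
      _ ≤ (w - v) * (2 * (w + v) * w) := by
        apply mul_le_mul_of_nonneg_left _ (by linarith)
        nlinarith
      _ = 2 * (w ^ 2 - v ^ 2) * w := by ring
      _ ≤ 2 * (w ^ 2 - v ^ 2) * √t := by gcongr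
  rw [sub_div] at h3
  linarith

lemma measure_bracketSum_shell_le (hE : Module.finrank ℝ E = 3) (m : E) {σ L : ℝ} (hσ : 0 ≤ σ)
    (hL : 0 ≤ L) :
    μ {k | σ < bracketSum m k ∧ bracketSum m k ≤ σ + L} ≤
      ENNReal.ofReal (5 * L * (σ + L) ^ 2 / 8) * μ (Metric.ball 0 1) := by
  have hb : μ (Metric.ball (0 : E) 1) ≠ ⊤ := measure_ball_lt_top.ne
  have hset : {k | σ < bracketSum m k ∧ bracketSum m k ≤ σ + L} =
      {k | bracketSum m k ≤ σ + L} \ {k | bracketSum m k ≤ σ} := by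
    ext k
    simp [and_comm]
  have hsub : {k | bracketSum m k ≤ σ} ⊆ {k | bracketSum m k ≤ σ + L} :=
    fun k (hk : bracketSum m k ≤ σ) => show bracketSum m k ≤ σ + L by linarith
  have hmeas : MeasurableSet {k | bracketSum m k ≤ σ} :=
    measurableSet_le (continuous_bracketSum m).measurable measurable_const
  rw [hset, measure_sdiff hsub hmeas.nullMeasurableSet
    (by rw [measure_bracketSum_le μ hE m hσ]; exact ENNReal.mul_ne_top ENNReal.ofReal_ne_top hb),
    measure_bracketSum_le μ hE m hσ, measure_bracketSum_le μ hE m (by linarith),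
    ← ENNReal.sub_mul (fun _ _ => hb), ← ENNReal.ofReal_sub _ (by positivity)]
  gcongr
  have h1 := sqrt_sub_pow_three_div_sqrt_sub_le
    (show σ ^ 2 - ‖m‖ ^ 2 ≤ (σ + L) ^ 2 - ‖m‖ ^ 2 by nlinarith)
  have h2 : √(σ ^ 2 - ‖m‖ ^ 2 - 4) ^ 3 / √(σ ^ 2 - ‖m‖ ^ 2) ≤ (σ + L) ^ 2 := by
    rcases lt_or_ge (σ ^ 2 - ‖m‖ ^ 2) 4 with h4 | h4
    · rw [Real.sqrt_eq_zero_of_nonpos (by linarith)]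
      simp only [ne_eq, OfNat.ofNat_ne_zero, not_false_eq_true, zero_pow, zero_div]
      positivity
    · have hz : 0 < √(σ ^ 2 - ‖m‖ ^ 2) := Real.sqrt_pos.2 (by linarith)
      have hw : √(σ ^ 2 - ‖m‖ ^ 2 - 4) ≤ √(σ ^ 2 - ‖m‖ ^ 2) := Real.sqrt_le_sqrt (by linarith)
      have hw2 := Real.sq_sqrt (show 0 ≤ σ ^ 2 - ‖m‖ ^ 2 - 4 by linarith)
      rw [div_le_iff₀ hz, pow_succ, hw2]
      have : σ ^ 2 - ‖m‖ ^ 2 - 4 ≤ (σ + L) ^ 2 := by nlinarith [norm_nonneg m]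
      gcongr
  set g := √(σ ^ 2 - ‖m‖ ^ 2 - 4) ^ 3 / √(σ ^ 2 - ‖m‖ ^ 2)
  set g' := √((σ + L) ^ 2 - ‖m‖ ^ 2 - 4) ^ 3 / √((σ + L) ^ 2 - ‖m‖ ^ 2)
  have h3 : (σ + L) * (g' - g) ≤ (σ + L) * (4 * L * (σ + L)) := by
    refine mul_le_mul_of_nonneg_left (h1.trans ?_) (by positivity)
    nlinarith [mul_nonneg hσ hL]
  have h4 : L * g ≤ L * (σ + L) ^ 2 := mul_le_mul_of_nonneg_left h2 hL
  linarith

/-- A `1`-separated finite family of points on which `bracketSum m` varies by at most one has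
at most quadratically many elements. -/
lemma card_bracketSum_le (hE : Module.finrank ℝ E = 3) (m : E) {ι : Type*} (T : Finset ι)
    (x : ι → E) (hx : ∀ i ∈ T, ∀ j ∈ T, i ≠ j → 1 ≤ dist (x i) (x j)) {c R : ℝ} (hR : 0 ≤ R)
    (hT : ∀ i ∈ T, c ≤ bracketSum m (x i) ∧ bracketSum m (x i) ≤ c + 1 ∧
      bracketSum m (x i) ≤ R) :
    (T.card : ℝ) ≤ 15 * (R + 3) ^ 2 := by
  borelize E
  let μ : Measure E := Measure.addHaar
  rcases T.eq_empty_or_nonempty with rfl | ⟨i₀, hi₀⟩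
  · simp only [Finset.card_empty, Nat.cast_zero]
    positivity
  have hc : c ≤ R := (hT i₀ hi₀).1.trans (hT i₀ hi₀).2.2
  have : Nontrivial E := Module.nontrivial_of_finrank_pos (R := ℝ) (by omega)
  have hb : μ (Metric.ball (0 : E) 1) ≠ ⊤ := measure_ball_lt_top.ne
  have hb0 : μ (Metric.ball (0 : E) 1) ≠ 0 := (Metric.measure_ball_pos μ 0 one_pos).ne'
  have hsub : (⋃ i ∈ T, Metric.ball (x i) (1 / 2)) ⊆
      {k | max (c - 1) 0 < bracketSum m k ∧ bracketSum m k ≤ max (c - 1) 0 + 3} := by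
    intro k hk
    simp only [Set.mem_iUnion, Metric.mem_ball] at hk
    obtain ⟨i, hi, hk⟩ := hk
    have h1 := bracketSum_le_add m k (x i)
    have h2 := bracketSum_le_add m (x i) k
    rw [← dist_eq_norm] at h1 h2
    rw [dist_comm] at h2
    have h3 := hT i hi
    refine ⟨max_lt (by linarith) ((norm_nonneg m).trans_lt (norm_lt_bracketSum m k)), ?_⟩
    linarith [le_max_left (c - 1) 0]
  have hvol := (measure_mono hsub).trans
    (measure_bracketSum_shell_le μ hE m (le_max_right (c - 1) 0) (by norm_num))
  rw [measure_biUnion_finset _ fun _ _ => Metric.isOpen_ball.measurableSet] at hvol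
  · simp_rw [Measure.addHaar_ball μ _ (show (0 : ℝ) ≤ 1 / 2 by norm_num), hE] at hvol
    rw [Finset.sum_const, nsmul_eq_mul, ← mul_assoc, ENNReal.mul_le_mul_iff_left hb0 hb,
      ← ENNReal.ofReal_natCast, ← ENNReal.ofReal_mul (by positivity),
      ENNReal.ofReal_le_ofReal_iff (by positivity)] at hvol
    have h1 : max (c - 1) 0 ≤ R := max_le (by linarith) hR
    have h2 : (max (c - 1) 0 + 3) ^ 2 ≤ (R + 3) ^ 2 := by gcongr
    linarith
  · intro i hi j hj hij
    refine Metric.ball_disjoint_ball ?_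
    norm_num
    exact hx i hi j hj hij

end Geometry

/-! ### Counting lattice points -/

lemma jbZ_eq_sqrt_norm (n : Fin 3 → ℤ) :
    jbZ n = √(1 + ‖WithLp.toLp 2 fun i => (n i : ℝ)‖ ^ 2) := by
  simp [jbZ, EuclideanSpace.norm_sq_eq]

lemma one_le_dist_toLp_intCast {ι : Type*} [Fintype ι] {n n' : ι → ℤ} (h : n ≠ n') :
    1 ≤ dist (WithLp.toLp 2 fun i => (n i : ℝ)) (WithLp.toLp 2 fun i => (n' i : ℝ)) := by
  obtain ⟨i, hi⟩ := Function.ne_iff.1 h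
  have h1 : (1 : ℝ) ≤ ‖(n i : ℝ) - n' i‖ := by
    rw [Real.norm_eq_abs]
    exact_mod_cast Int.one_le_abs (sub_ne_zero.2 hi)
  rw [dist_eq_norm]
  exact h1.trans (PiLp.norm_apply_le
    ((WithLp.toLp 2 fun i => (n i : ℝ)) - WithLp.toLp 2 fun i => (n' i : ℝ)) i)

lemma jbZ_le_of_mem_annulus {N : ℝ} (hN : 1 ≤ N) {n : Fin 3 → ℤ} (hn : n ∈ annulus N) :
    jbZ n ≤ 3 * N := by
  have h : normZ n < 2 * N := (Finset.mem_filter.1 hn).2.2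
  have h2 : ∑ i, ((n i : ℝ)) ^ 2 < (2 * N) ^ 2 := (Real.sqrt_lt' (by linarith)).1 h
  rw [jbZ, Real.sqrt_le_left (by linarith)]
  nlinarith

lemma card_annulus_le {N : ℝ} (hN : 1 ≤ N) (l : Fin 3 → ℤ) (T : Finset (Fin 3 → ℤ))
    (hT : ∀ n ∈ T, n ∈ annulus N ∧ l - n ∈ annulus N) (c : ℝ)
    (hc : ∀ n ∈ T, c ≤ jbZ n + jbZ (l - n) ∧ jbZ n + jbZ (l - n) ≤ c + 1) :
    (T.card : ℝ) ≤ 1215 * N ^ 2 := by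
  let v (n : Fin 3 → ℤ) : EuclideanSpace ℝ (Fin 3) := WithLp.toLp 2 fun i => (n i : ℝ)
  have hb (n : Fin 3 → ℤ) :
      bracketSum (v l) (v n - (1 / 2 : ℝ) • v l) = jbZ n + jbZ (l - n) := by
    have h1 : v n - (1 / 2 : ℝ) • v l + (1 / 2 : ℝ) • v l = v n := by module
    have h2 : v n - (1 / 2 : ℝ) • v l - (1 / 2 : ℝ) • v l = -v (l - n) := by
      have : v (l - n) = v l - v n := by
        ext i
        simp [v]
      rw [this]
      module
    rw [bracketSum, h1, h2, norm_neg, jbZ_eq_sqrt_norm, jbZ_eq_sqrt_norm]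
  have h := card_bracketSum_le (by simp) (v l) T (fun n => v n - (1 / 2 : ℝ) • v l)
    (fun n _ n' _ hne => by
      rw [dist_sub_right]
      exact one_le_dist_toLp_intCast hne)
    (c := c) (R := 6 * N) (by linarith) fun n hn => by
      rw [hb]
      have h1 := jbZ_le_of_mem_annulus hN (hT n hn).1
      have h2 := jbZ_le_of_mem_annulus hN (hT n hn).2
      exact ⟨(hc n hn).1, (hc n hn).2, by linarith⟩
  nlinarith

/-! ### Gaussian sums over families with few members in each unit window -/

lemma exp_neg_sq_div_two_le (x : ℝ) :
    Real.exp (-x ^ 2 / 2) ≤ 2 * (1 / 2) ^ ⌊|x|⌋₊ := by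
  have h1 : (⌊|x|⌋₊ : ℝ) ≤ |x| := Nat.floor_le (abs_nonneg x)
  have h2 : -x ^ 2 / 2 ≤ 1 / 2 + ⌊|x|⌋₊ * (-1) := by
    nlinarith [sq_nonneg (|x| - 1), sq_abs x]
  have h3 : Real.exp (1 / 2) ≤ 2 := by
    have h := Real.exp_one_lt_d9
    have h' : Real.exp (1 / 2) ^ 2 = Real.exp 1 := by
      rw [← Real.exp_nat_mul]
      norm_num
    nlinarith [Real.exp_pos (1 / 2)]
  have h4 : Real.exp (-1) ≤ 1 / 2 := by
    rw [Real.exp_neg, one_div]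
    exact inv_anti₀ two_pos (by linarith [Real.add_one_le_exp 1])
  calc Real.exp (-x ^ 2 / 2) ≤ Real.exp (1 / 2 + ⌊|x|⌋₊ * (-1)) := Real.exp_le_exp.2 h2
    _ = Real.exp (1 / 2) * Real.exp (-1) ^ ⌊|x|⌋₊ := by rw [Real.exp_add, Real.exp_nat_mul]
    _ ≤ 2 * (1 / 2) ^ ⌊|x|⌋₊ := by gcongr

lemma sum_exp_neg_sq_le {ι : Type*} (T : Finset ι) (f : ι → ℝ) {M : ℝ}
    (hM : ∀ (U : Finset ι) (c : ℝ), U ⊆ T → (∀ i ∈ U, c ≤ f i ∧ f i ≤ c + 1) →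
      (U.card : ℝ) ≤ M) :
    ∑ i ∈ T, Real.exp (-f i ^ 2 / 2) ≤ 8 * M := by
  classical
  have hM0 : 0 ≤ M := by simpa using hM ∅ 0 (Finset.empty_subset _) (by simp)
  have hcard (k : ℕ) : ((T.filter fun i => ⌊|f i|⌋₊ = k).card : ℝ) ≤ 2 * M := by
    set U := T.filter fun i => ⌊|f i|⌋₊ = k with hU
    have hk (i : ι) (hi : i ∈ U) : (k : ℝ) ≤ |f i| ∧ |f i| ≤ k + 1 := by
      have h := (Finset.mem_filter.1 hi).2
      have h1 := Nat.floor_le (abs_nonneg (f i))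
      have h2 := (Nat.lt_floor_add_one |f i|).le
      rw [h] at h1 h2
      exact ⟨h1, h2⟩
    have hsplit := U.card_filter_add_card_filter_not (fun i => 0 ≤ f i)
    have h1 := hM (U.filter fun i => 0 ≤ f i) k
      ((Finset.filter_subset _ _).trans (Finset.filter_subset _ _)) fun i hi => by
        have h := hk i (Finset.mem_filter.1 hi).1
        rwa [abs_of_nonneg (Finset.mem_filter.1 hi).2] at h
    have h2 := hM (U.filter fun i => ¬0 ≤ f i) (-(k + 1))
      ((Finset.filter_subset _ _).trans (Finset.filter_subset _ _)) fun i hi => by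
        have h := hk i (Finset.mem_filter.1 hi).1
        rw [abs_of_neg (not_le.1 (Finset.mem_filter.1 hi).2)] at h
        constructor <;> linarith
    have h3 : ((U.filter fun i => 0 ≤ f i).card : ℝ) + (U.filter fun i => ¬0 ≤ f i).card =
        U.card := by exact_mod_cast hsplit
    linarith
  let s := T.image fun i => ⌊|f i|⌋₊
  calc ∑ i ∈ T, Real.exp (-f i ^ 2 / 2) ≤ ∑ i ∈ T, 2 * (1 / 2 : ℝ) ^ ⌊|f i|⌋₊ :=
        Finset.sum_le_sum fun i _ => exp_neg_sq_div_two_le _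
    _ = ∑ k ∈ s, ∑ i ∈ T.filter (fun i => ⌊|f i|⌋₊ = k), 2 * (1 / 2 : ℝ) ^ ⌊|f i|⌋₊ :=
        (Finset.sum_fiberwise_of_maps_to (fun i hi => Finset.mem_image_of_mem _ hi) _).symm
    _ = ∑ k ∈ s, ((T.filter fun i => ⌊|f i|⌋₊ = k).card : ℝ) * (2 * (1 / 2 : ℝ) ^ k) := by
        refine Finset.sum_congr rfl fun k _ => ?_
        rw [← nsmul_eq_mul]
        refine Finset.sum_eq_card_nsmul fun i hi => ?_
        rw [(Finset.mem_filter.1 hi).2]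
    _ ≤ ∑ k ∈ s, 2 * M * (2 * (1 / 2 : ℝ) ^ k) :=
        Finset.sum_le_sum fun k _ => mul_le_mul_of_nonneg_right (hcard k) (by positivity)
    _ = 4 * M * ∑ k ∈ s, (1 / 2 : ℝ) ^ k := by
        rw [Finset.mul_sum]
        exact Finset.sum_congr rfl fun k _ => by ring
    _ ≤ 4 * M * 2 := by
        refine mul_le_mul_of_nonneg_left ?_ (by positivity)
        exact (summable_geometric_two.sum_le_tsum _ fun _ _ => by positivity).trans_eq
          tsum_geometric_two
    _ = 8 * M := by ring

/-! ### Almost orthogonality -/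

/-- Schur's test for the Gram matrix of a finite family of functions. -/
lemma integral_norm_sum_sq_le {Ω ι : Type*} [MeasurableSpace Ω] (μ : Measure Ω) (P : Finset ι)
    (b : ι → ℂ) (e : ι → Ω → ℂ) (B : ℝ)
    (he : ∀ p ∈ P, ∀ q ∈ P, Integrable (fun ω => e p ω * starRingEnd ℂ (e q ω)) μ)
    (hB : ∀ p ∈ P, ∑ q ∈ P, ‖∫ ω, e p ω * starRingEnd ℂ (e q ω) ∂μ‖ ≤ B) :
    ∫ ω, ‖∑ p ∈ P, b p * e p ω‖ ^ 2 ∂μ ≤ B * ∑ p ∈ P, ‖b p‖ ^ 2 := by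
  set K : ι → ι → ℂ := fun p q => ∫ ω, e p ω * starRingEnd ℂ (e q ω) ∂μ with hK
  have hsymm (p q : ι) : ‖K q p‖ = ‖K p q‖ := by
    rw [← RCLike.norm_conj (K p q), hK]
    simp only [← integral_conj, map_mul, RCLike.conj_conj, mul_comm]
  have hexp : ((∫ ω, ‖∑ p ∈ P, b p * e p ω‖ ^ 2 ∂μ : ℝ) : ℂ) =
      ∑ p ∈ P, ∑ q ∈ P, b p * starRingEnd ℂ (b q) * K p q := by
    have hpt (ω : Ω) : ((‖∑ p ∈ P, b p * e p ω‖ ^ 2 : ℝ) : ℂ) = ∑ p ∈ P, ∑ q ∈ P,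
        b p * starRingEnd ℂ (b q) * (e p ω * starRingEnd ℂ (e q ω)) := by
      rw [Complex.ofReal_pow, ← Complex.mul_conj', map_sum, Finset.sum_mul_sum]
      refine Finset.sum_congr rfl fun p _ => Finset.sum_congr rfl fun q _ => ?_
      rw [map_mul]
      ring
    rw [← integral_complex_ofReal]
    simp_rw [hpt]
    rw [integral_finsetSum _ fun p hp => integrable_finsetSum _ fun q hq =>
      (he p hp q hq).const_mul _]
    refine Finset.sum_congr rfl fun p hp => ?_
    rw [integral_finsetSum _ fun q hq => (he p hp q hq).const_mul _]
    exact Finset.sum_congr rfl fun q _ => integral_const_mul _ _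
  have hrow (p : ι) (hp : p ∈ P) : ∑ q ∈ P, ‖b p‖ ^ 2 * ‖K p q‖ ≤ B * ‖b p‖ ^ 2 := by
    rw [← Finset.mul_sum, mul_comm B]
    exact mul_le_mul_of_nonneg_left (hB p hp) (by positivity)
  calc ∫ ω, ‖∑ p ∈ P, b p * e p ω‖ ^ 2 ∂μ
      ≤ ‖((∫ ω, ‖∑ p ∈ P, b p * e p ω‖ ^ 2 ∂μ : ℝ) : ℂ)‖ := by
        rw [Complex.norm_real]
        exact le_abs_self _
    _ ≤ ∑ p ∈ P, ∑ q ∈ P, ‖b p‖ * ‖b q‖ * ‖K p q‖ := by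
        rw [hexp]
        refine (norm_sum_le _ _).trans (Finset.sum_le_sum fun p _ => (norm_sum_le _ _).trans
          (Finset.sum_le_sum fun q _ => ?_))
        rw [norm_mul, norm_mul, RCLike.norm_conj]
    _ ≤ ∑ p ∈ P, ∑ q ∈ P, (‖b p‖ ^ 2 * ‖K p q‖ / 2 + ‖b q‖ ^ 2 * ‖K q p‖ / 2) := by
        refine Finset.sum_le_sum fun p _ => Finset.sum_le_sum fun q _ => ?_
        rw [hsymm p q]
        nlinarith [mul_nonneg (sq_nonneg (‖b p‖ - ‖b q‖)) (norm_nonneg (K p q))]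
    _ = ∑ p ∈ P, ∑ q ∈ P, ‖b p‖ ^ 2 * ‖K p q‖ := by
        simp_rw [Finset.sum_add_distrib]
        rw [Finset.sum_comm (f := fun p q => ‖b q‖ ^ 2 * ‖K q p‖ / 2)]
        simp_rw [← Finset.sum_div]
        ring
    _ ≤ B * ∑ p ∈ P, ‖b p‖ ^ 2 := by
        rw [Finset.mul_sum]
        exact Finset.sum_le_sum hrow

/-! ### Space-time exponentials -/

section SpaceTime

open ProbabilityTheory

/-- The space-time exponential `exp (i (n·x + t⟨n⟩))`. -/
noncomputable def kgExp (n : Fin 3 → ℤ) (p : ℝ × (Fin 3 → ℝ)) : ℂ :=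
  Complex.exp (Complex.I * ((dotZ n p.2 + p.1 * jbZ n : ℝ) : ℂ))

lemma continuous_kgExp (n : Fin 3 → ℤ) : Continuous (kgExp n) := by
  unfold kgExp dotZ
  fun_prop

lemma norm_kgExp (n : Fin 3 → ℤ) (p : ℝ × (Fin 3 → ℝ)) : ‖kgExp n p‖ = 1 := by
  rw [kgExp, mul_comm, Complex.norm_exp_ofReal_mul_I]

lemma conj_kgExp (n : Fin 3 → ℤ) (p : ℝ × (Fin 3 → ℝ)) :
    starRingEnd ℂ (kgExp n p) =
      Complex.exp (-(Complex.I * ((dotZ n p.2 + p.1 * jbZ n : ℝ) : ℂ))) := by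
  rw [kgExp, ← Complex.exp_conj, map_mul, Complex.conj_I, Complex.conj_ofReal, neg_mul]

lemma integral_Ico_exp_int_mul (j : ℤ) :
    ∫ x in Set.Ico 0 (2 * Real.pi), Complex.exp (j * Complex.I * x) =
      if j = 0 then ((2 * Real.pi : ℝ) : ℂ) else 0 := by
  rw [integral_Ico_eq_integral_Ioc, ← intervalIntegral.integral_of_le (by positivity)]
  split_ifs with h
  · simp [h]
  · rw [integral_exp_mul_complex (by simp [h])]
    have : Complex.exp (j * Complex.I * (2 * Real.pi : ℝ)) = 1 := by
      rw [← Complex.exp_int_mul_two_pi_mul_I j]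
      push_cast
      ring_nf
    rw [this]
    simp

lemma integral_cube_exp_dotZ (l : Fin 3 → ℤ) :
    ∫ x in cube, Complex.exp (Complex.I * (dotZ l x : ℂ)) =
      if l = 0 then (((2 * Real.pi) ^ 3 : ℝ) : ℂ) else 0 := by
  have h (x : Fin 3 → ℝ) : Complex.exp (Complex.I * (dotZ l x : ℂ)) =
      ∏ i, Complex.exp (l i * Complex.I * x i) := by
    rw [← Complex.exp_sum, dotZ, Complex.ofReal_sum, Finset.mul_sum]
    congr 1
    refine Finset.sum_congr rfl fun i _ => ?_
    push_cast
    ring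
  simp_rw [h]
  rw [cube, volume_pi, Measure.restrict_pi_pi,
    integral_fintype_prod_eq_prod (fun i (y : ℝ) => Complex.exp (l i * Complex.I * y))]
  simp_rw [integral_Ico_exp_int_mul]
  split_ifs with h0
  · simp [h0]
  · obtain ⟨i, hi⟩ := Function.ne_iff.1 h0
    exact Finset.prod_eq_zero (Finset.mem_univ i) (if_neg hi)

/-- The weighted space-time measure: Gaussian in time, Lebesgue measure of the torus in space. -/
noncomputable def weightedMeasure : Measure (ℝ × (Fin 3 → ℝ)) :=
  (gaussianReal 0 1).prod (volume.restrict cube)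

instance isFiniteMeasure_restrict_cube : IsFiniteMeasure (volume.restrict cube) := by
  constructor
  rw [Measure.restrict_apply_univ, cube, volume_pi_pi]
  exact ENNReal.prod_lt_top fun _ _ => measure_Ico_lt_top

instance isFiniteMeasure_weightedMeasure : IsFiniteMeasure weightedMeasure := by
  unfold weightedMeasure
  infer_instance

lemma integral_kgExp (n₁ n₂ n₃ n₄ : Fin 3 → ℤ) :
    ∫ p, kgExp n₁ p * kgExp n₂ p * starRingEnd ℂ (kgExp n₃ p * kgExp n₄ p) ∂weightedMeasure =
      if n₃ + n₄ = n₁ + n₂ then (((2 * Real.pi) ^ 3 *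
        Real.exp (-(jbZ n₃ + jbZ n₄ - (jbZ n₁ + jbZ n₂)) ^ 2 / 2) : ℝ) : ℂ) else 0 := by
  set ω : ℝ := jbZ n₁ + jbZ n₂ - (jbZ n₃ + jbZ n₄) with hω
  set l : Fin 3 → ℤ := n₁ + n₂ - (n₃ + n₄) with hl
  have h (p : ℝ × (Fin 3 → ℝ)) :
      kgExp n₁ p * kgExp n₂ p * starRingEnd ℂ (kgExp n₃ p * kgExp n₄ p) =
        Complex.exp (ω * p.1 * Complex.I) * Complex.exp (Complex.I * (dotZ l p.2 : ℂ)) := by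
    have hdot : dotZ l p.2 = dotZ n₁ p.2 + dotZ n₂ p.2 - (dotZ n₃ p.2 + dotZ n₄ p.2) := by
      simp only [dotZ, ← Finset.sum_add_distrib, ← Finset.sum_sub_distrib]
      refine Finset.sum_congr rfl fun i _ => ?_
      simp only [hl, Pi.sub_apply, Pi.add_apply]
      push_cast
      ring
    rw [map_mul, conj_kgExp, conj_kgExp, kgExp, kgExp, ← Complex.exp_add, ← Complex.exp_add,
      ← Complex.exp_add, ← Complex.exp_add, hdot, hω]
    congr 1
    push_cast
    ring
  simp_rw [h]
  rw [weightedMeasure, integral_prod_mul (fun t : ℝ => Complex.exp (ω * t * Complex.I))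
    (fun x => Complex.exp (Complex.I * (dotZ l x : ℂ))), ← charFun_apply_real,
    charFun_gaussianReal, integral_cube_exp_dotZ]
  have hl0 : l = 0 ↔ n₃ + n₄ = n₁ + n₂ := by rw [hl, sub_eq_zero, eq_comm]
  simp only [hl0]
  split_ifs
  · push_cast
    rw [mul_comm, hω]
    congr 2
    push_cast
    ring
  · simp

lemma sum_norm_integral_kgExp_le {N : ℝ} (hN : 1 ≤ N) (n₁ n₂ : Fin 3 → ℤ) :
    ∑ q ∈ annulus N ×ˢ annulus N,
      ‖∫ p, kgExp n₁ p * kgExp n₂ p * starRingEnd ℂ (kgExp q.1 p * kgExp q.2 p)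
        ∂weightedMeasure‖ ≤ (2 * Real.pi) ^ 3 * (8 * (1215 * N ^ 2)) := by
  classical
  set l := n₁ + n₂ with hl
  set T := (annulus N).filter fun n => l - n ∈ annulus N with hT
  have hinner (n : Fin 3 → ℤ) : ∑ n' ∈ annulus N,
      ‖∫ p, kgExp n₁ p * kgExp n₂ p * starRingEnd ℂ (kgExp n p * kgExp n' p)
        ∂weightedMeasure‖ = if l - n ∈ annulus N then (2 * Real.pi) ^ 3 *
          Real.exp (-(jbZ n + jbZ (l - n) - (jbZ n₁ + jbZ n₂)) ^ 2 / 2) else 0 := by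
    rw [← Finset.sum_ite_eq' (annulus N) (l - n) fun n' => (2 * Real.pi) ^ 3 *
      Real.exp (-(jbZ n + jbZ n' - (jbZ n₁ + jbZ n₂)) ^ 2 / 2)]
    refine Finset.sum_congr rfl fun n' _ => ?_
    have : n + n' = n₁ + n₂ ↔ n' = l - n := by rw [eq_sub_iff_add_eq', hl]
    rw [integral_kgExp]
    simp only [this]
    split_ifs
    · rw [Complex.norm_real, Real.norm_of_nonneg (by positivity)]
    · exact norm_zero
  rw [Finset.sum_product]
  simp_rw [hinner]
  rw [← Finset.sum_filter, ← Finset.mul_sum]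
  refine mul_le_mul_of_nonneg_left ?_ (by positivity)
  refine sum_exp_neg_sq_le _ _ fun U c hU hc => ?_
  refine card_annulus_le hN l U (fun n hn => Finset.mem_filter.1 (hU hn))
    (c + (jbZ n₁ + jbZ n₂)) fun n hn => ?_
  have := hc n hn
  constructor <;> linarith

lemma integral_norm_pow_four_le {N : ℝ} (hN : 1 ≤ N) (coef : (Fin 3 → ℤ) → ℂ) :
    ∫ p, ‖∑ n ∈ annulus N, coef n * kgExp n p‖ ^ 4 ∂weightedMeasure ≤
      (2 * Real.pi) ^ 3 * (8 * (1215 * N ^ 2)) * (∑ n ∈ annulus N, ‖coef n‖ ^ 2) ^ 2 := by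
  have h := integral_norm_sum_sq_le weightedMeasure (annulus N ×ˢ annulus N)
    (fun q => coef q.1 * coef q.2) (fun q p => kgExp q.1 p * kgExp q.2 p)
    ((2 * Real.pi) ^ 3 * (8 * (1215 * N ^ 2))) (fun q _ r _ => by
      have h1 := continuous_kgExp
      refine Integrable.of_bound (C := 1) (Continuous.aestronglyMeasurable (by fun_prop))
        (Filter.Eventually.of_forall fun p => ?_)
      simp [norm_kgExp]) fun q _ => sum_norm_integral_kgExp_le hN q.1 q.2
  have hsum : ∑ q ∈ annulus N ×ˢ annulus N, ‖coef q.1 * coef q.2‖ ^ 2 =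
      (∑ n ∈ annulus N, ‖coef n‖ ^ 2) ^ 2 := by
    rw [sq (∑ n ∈ annulus N, ‖coef n‖ ^ 2), Finset.sum_mul_sum, Finset.sum_product]
    simp_rw [norm_mul, mul_pow]
  rw [hsum] at h
  refine le_of_eq_of_le (integral_congr_ae (Filter.Eventually.of_forall fun p => ?_)) h
  have : ∑ q ∈ annulus N ×ˢ annulus N, coef q.1 * coef q.2 * (kgExp q.1 p * kgExp q.2 p) =
      (∑ n ∈ annulus N, coef n * kgExp n p) ^ 2 := by
    rw [sq, Finset.sum_mul_sum, Finset.sum_product]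
    exact Finset.sum_congr rfl fun n _ => Finset.sum_congr rfl fun n' _ => by ring
  simp only [this, norm_pow, ← pow_mul]

lemma exists_restrict_Icc_le_smul_gaussianReal (a b : ℝ) :
    ∃ K : NNReal, 0 < K ∧ volume.restrict (Set.Icc a b) ≤ K • gaussianReal 0 1 := by
  set c : NNReal := (gaussianPDFReal 0 1 (max |a| |b|)).toNNReal with hc
  have hc0 : 0 < c := Real.toNNReal_pos.2 (gaussianPDFReal_pos 0 1 _ one_ne_zero)
  have hpdf (x : ℝ) (hx : x ∈ Set.Icc a b) : (c : ENNReal) ≤ gaussianPDF 0 1 x := by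
    rw [gaussianPDF, hc, ← ENNReal.ofReal]
    refine ENNReal.ofReal_le_ofReal ?_
    have hx2 : x ^ 2 ≤ max |a| |b| ^ 2 := by
      rw [← sq_abs x]
      exact pow_le_pow_left₀ (abs_nonneg x) (abs_le_max_abs_abs hx.1 hx.2) 2
    simp only [gaussianPDFReal, sub_zero]
    gcongr
  refine ⟨c⁻¹, inv_pos.2 hc0, Measure.le_iff.2 fun s hs => ?_⟩
  rw [Measure.restrict_apply hs, Measure.smul_apply, ENNReal.smul_def, smul_eq_mul,
    ENNReal.coe_inv hc0.ne', mul_comm, ← div_eq_mul_inv,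
    ENNReal.le_div_iff_mul_le (by simp [hc0.ne']) (by simp), mul_comm]
  calc (c : ENNReal) * volume (s ∩ Set.Icc a b) = ∫⁻ _ in s ∩ Set.Icc a b, c := by
        rw [setLIntegral_const]
    _ ≤ ∫⁻ x in s ∩ Set.Icc a b, gaussianPDF 0 1 x :=
        setLIntegral_mono (measurable_gaussianPDF 0 1) fun x hx => hpdf x hx.2
    _ = gaussianReal 0 1 (s ∩ Set.Icc a b) := (gaussianReal_apply 0 one_ne_zero _).symm
    _ ≤ gaussianReal 0 1 s := measure_mono Set.inter_subset_left

end SpaceTime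

/-- **L⁴ Strichartz estimate for Klein–Gordon exponential sums**
(Proposition 4.2, first estimate).  For every bounded interval `I = [a, b] ⊂ ℝ` there is a
constant `C(I) > 0` such that for every `N ≥ 1` and all complex coefficients `(a(n))_{n ∈ S_N}`,
the function `f(t,x) = ∑_{n ∈ S_N} a(n) exp(i(n·x + t⟨n⟩))` satisfies
`‖f‖_{L⁴(I × T³)} ≤ C(I) N^{1/2} (∑_{n ∈ S_N} |a(n)|²)^{1/2}`. -/
theorem strichartz_L4_exponential_sum (a b : ℝ) :
    ∃ C > (0:ℝ), ∀ N : ℝ, 1 ≤ N → ∀ coef : (Fin 3 → ℤ) → ℂ,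
      eLpNorm
        (fun p : ℝ × (Fin 3 → ℝ) =>
          ∑ n ∈ annulus N, coef n * Complex.exp (Complex.I * ((dotZ n p.2 + p.1 * jbZ n : ℝ) : ℂ)))
        4 (volume.restrict (Set.Icc a b ×ˢ cube)) ≤
      ENNReal.ofReal (C * N ^ ((1:ℝ)/2) * Real.sqrt (∑ n ∈ annulus N, ‖coef n‖ ^ 2)) := by
  obtain ⟨K, hK, hle⟩ := exists_restrict_Icc_le_smul_gaussianReal a b
  set B : ℝ := K * ((2 * Real.pi) ^ 3 * (8 * 1215)) with hB
  have hB0 : 0 < B := by positivity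
  refine ⟨B ^ ((1 : ℝ) / 4), by positivity, fun N hN coef => ?_⟩
  set A : ℝ := ∑ n ∈ annulus N, ‖coef n‖ ^ 2 with hA
  have hA0 : 0 ≤ A := Finset.sum_nonneg fun _ _ => by positivity
  have hμ : volume.restrict (Set.Icc a b ×ˢ cube) ≤ K • weightedMeasure := by
    rw [Measure.volume_eq_prod, ← Measure.prod_restrict, weightedMeasure,
      ← Measure.prod_smul_left]
    exact Measure.prod_mono hle le_rfl
  have hcont : Continuous fun p => ∑ n ∈ annulus N, coef n * kgExp n p := by
    have := continuous_kgExp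
    fun_prop
  have hint : Integrable (fun p => ‖∑ n ∈ annulus N, coef n * kgExp n p‖ ^ 4)
      weightedMeasure := by
    refine Integrable.of_bound (C := (∑ n ∈ annulus N, ‖coef n‖) ^ 4)
      (hcont.norm.pow 4).aestronglyMeasurable (Filter.Eventually.of_forall fun p => ?_)
    rw [norm_pow, norm_norm]
    gcongr
    refine norm_sum_le_of_le _ fun n _ => ?_
    rw [norm_mul, norm_kgExp, mul_one]
  have hX : (B ^ ((1 : ℝ) / 4) * N ^ ((1 : ℝ) / 2) * √A) ^ 4 = B * N ^ 2 * A ^ 2 := by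
    have h1 : (B ^ ((1 : ℝ) / 4)) ^ 4 = B := by
      rw [← Real.rpow_mul_natCast hB0.le]
      norm_num
    have h2 : (N ^ ((1 : ℝ) / 2)) ^ 4 = N ^ 2 := by
      rw [← Real.rpow_mul_natCast (by linarith), ← Real.rpow_natCast N 2]
      norm_num
    have h3 : √A ^ 4 = A ^ 2 := by
      rw [show 4 = 2 * 2 from rfl, pow_mul, Real.sq_sqrt hA0]
    rw [mul_pow, mul_pow, h1, h2, h3]
  rw [eLpNorm_eq_lintegral_rpow_enorm_toReal (by norm_num) (by norm_num),
    one_div, ENNReal.rpow_inv_le_iff (by norm_num)]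
  have hfour : (4 : ENNReal).toReal = (4 : ℕ) := by norm_num
  simp_rw [hfour, ENNReal.rpow_natCast]
  rw [← ENNReal.ofReal_pow (by positivity), hX]
  calc ∫⁻ p in Set.Icc a b ×ˢ cube, ‖∑ n ∈ annulus N, coef n * kgExp n p‖ₑ ^ 4
      ≤ ∫⁻ p, ‖∑ n ∈ annulus N, coef n * kgExp n p‖ₑ ^ 4 ∂(K • weightedMeasure) :=
        lintegral_mono' hμ le_rfl
    _ = K * ∫⁻ p, ENNReal.ofReal (‖∑ n ∈ annulus N, coef n * kgExp n p‖ ^ 4)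
          ∂weightedMeasure := by
        rw [lintegral_smul_measure, ENNReal.smul_def, smul_eq_mul]
        simp_rw [ENNReal.ofReal_pow (norm_nonneg _), ofReal_norm]
    _ ≤ K * ENNReal.ofReal ((2 * Real.pi) ^ 3 * (8 * (1215 * N ^ 2)) * A ^ 2) := by
        rw [← ofReal_integral_eq_lintegral_ofReal hint
          (Filter.Eventually.of_forall fun _ => by positivity)]
        gcongr
        exact integral_norm_pow_four_le hN coef
    _ = ENNReal.ofReal (B * N ^ 2 * A ^ 2) := by
        rw [← ENNReal.ofReal_coe_nnreal, ← ENNReal.ofReal_mul (by positivity), hB]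
        congr 1
        ring
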